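/- arXiv:1304.0463 — 2 statements merged into one kernel-verified Lean document; each statement's English description precedes it below -/
import Mathlib

section
/- With the cancellation data, π is a D-structure morphism from (N, δ) to (N̄, δ̄): (μ ⊗ id_N̄) ∘ (id_A ⊗ δ̄) ∘ π − (μ ⊗ id_N̄) ∘ (id_A ⊗ π) ∘ δ + (d ⊗ ε_N̄) ∘ π = 0 as R-linear maps N → A ⊗[R] N̄. -/
open TensorProduct

noncomputable section

/-- The sign `(-1)^j` for an integer `j`. -/
def zsign (j : ℤ) : ℤ := (((-1 : ℤˣ) ^ j : ℤˣ) : ℤ)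

/-- The collapse map `A ⊗ (A ⊗ M) → A ⊗ M`, i.e. `(μ ⊗ id)` after reassociation. -/
def mu2 (R A M : Type*) [CommRing R] [Ring A] [Algebra R A]
    [AddCommGroup M] [Module R M] :
    A ⊗[R] (A ⊗[R] M) →ₗ[R] A ⊗[R] M :=
  (TensorProduct.map (LinearMap.mul' R A) (LinearMap.id : M →ₗ[R] M)) ∘ₗ
    (TensorProduct.assoc R A A M).symm.toLinearMap

/-- The composition `f ∗ g = (μ ⊗ id) ∘ (id_A ⊗ f) ∘ g` of type-D-style maps. -/
def dstar {R A : Type*} [CommRing R] [Ring A] [Algebra R A]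
    {M₁ M₂ M₃ : Type*} [AddCommGroup M₁] [Module R M₁]
    [AddCommGroup M₂] [Module R M₂] [AddCommGroup M₃] [Module R M₃]
    (f : M₂ →ₗ[R] A ⊗[R] M₃) (g : M₁ →ₗ[R] A ⊗[R] M₂) :
    M₁ →ₗ[R] A ⊗[R] M₃ :=
  mu2 R A M₃ ∘ₗ LinearMap.lTensor A f ∘ₗ g


theorem mu2_tmul_tmul {R A M : Type*} [CommRing R] [Ring A] [Algebra R A]
    [AddCommGroup M] [Module R M] (b c : A) (x : M) :
    mu2 R A M (b ⊗ₜ[R] (c ⊗ₜ[R] x)) = (b * c) ⊗ₜ[R] x := by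
  simp [mu2]

/-- Composition of type-D-style maps is multiplication of coefficient matrices. -/
theorem dstar_apply_of_coeff {R A : Type*} [CommRing R] [Ring A] [Algebra R A]
    {M₁ M₂ M₃ : Type*} [AddCommGroup M₁] [Module R M₁]
    [AddCommGroup M₂] [Module R M₂] [AddCommGroup M₃] [Module R M₃]
    {ι κ : Type*} [Fintype ι] [Fintype κ]
    (f : M₂ →ₗ[R] A ⊗[R] M₃) (g : M₁ →ₗ[R] A ⊗[R] M₂)
    {x : M₁} {y : ι → M₂} {z : κ → M₃} {b : ι → A} {c : ι → κ → A}
    (hg : g x = ∑ j, b j ⊗ₜ[R] y j) (hf : ∀ j, f (y j) = ∑ k, c j k ⊗ₜ[R] z k) :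
    dstar f g x = ∑ k, (∑ j, b j * c j k) ⊗ₜ[R] z k := by
  simp only [dstar, LinearMap.comp_apply, hg, map_sum, LinearMap.lTensor_tmul, hf,
    TensorProduct.tmul_sum, mu2_tmul_tmul, TensorProduct.sum_tmul]
  exact Finset.sum_comm

/-- Split off the first two terms of a sum over `Fin n`. -/
theorem sum_fin_eq_add_add_sum_two_le {B : Type*} [AddCommMonoid B] {n : ℕ} {i₀ i₁ : Fin n}
    (h₀ : (i₀ : ℕ) = 0) (h₁ : (i₁ : ℕ) = 1) (f : Fin n → B) :
    ∑ j, f j = f i₀ + f i₁ + ∑ j : {j : Fin n // 2 ≤ (j : ℕ)}, f j.1 := by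
  obtain ⟨k, rfl⟩ : ∃ k, n = k + 2 := ⟨n - 2, by omega⟩
  obtain rfl : i₀ = 0 := Fin.ext h₀
  obtain rfl : i₁ = Fin.succ 0 := Fin.ext h₁
  rw [Fin.sum_univ_succ, Fin.sum_univ_succ, ← add_assoc]
  congr 1
  refine Finset.sum_bij (fun (i : Fin k) _ => ⟨i.succ.succ, by simp⟩) (by simp) ?_ ?_ (by simp)
  · intro i _ j _ h
    simpa using h
  · rintro ⟨⟨j, hj⟩, hj'⟩ _
    have hj'' : 2 ≤ j := hj'
    refine ⟨⟨j - 2, by omega⟩, Finset.mem_univ _, ?_⟩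
    ext
    simp
    omega

/-- with the cancellation data, `π` is a `D`-structure morphism from
`(N, δ)` to `(N̄, δ̄)`:
`(μ ⊗ id_N̄) ∘ (id_A ⊗ δ̄) ∘ π − (μ ⊗ id_N̄) ∘ (id_A ⊗ π) ∘ δ + (d ⊗ ε_N̄) ∘ π = 0`.
(Paper indices `1, 2` correspond to the Lean indices `⟨0,_⟩, ⟨1,_⟩` of `Fin n`,
and `i ≥ 3` to `2 ≤ (i : ℕ)`.) -/
theorem pi_is_D_structure_morphism
    {R A : Type*} [CommRing R] [Ring A] [Algebra R A]
    (𝒜 : ℤ → Submodule R A) [GradedAlgebra 𝒜]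
    (d : A →ₗ[R] A) (hd1 : d 1 = 0)
    (hLeib : ∀ (j : ℤ) (α β : A), β ∈ 𝒜 j →
      d (α * β) = zsign j • (d α * β) + α * d β)
    (n : ℕ) (hn : 2 ≤ n) (m : Fin n → ℤ) (a : Fin n → Fin n → A)
    (ha : ∀ i j, a i j ∈ 𝒜 (m i - m j + 1))
    (hstruct : ∀ i k, zsign (m k) • d (a i k) + ∑ j, a i j * a j k = 0)
    (haii : ∀ i, a i i = 0)
    (ha12 : a ⟨0, by omega⟩ ⟨1, by omega⟩ = 1)
    (hm : m ⟨1, by omega⟩ = m ⟨0, by omega⟩ + 1)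
    (abar : Fin n → Fin n → A)
    (habar : ∀ i j, abar i j = a i j - a i ⟨1, by omega⟩ * a ⟨0, by omega⟩ j)
    (δ : (Fin n → R) →ₗ[R] A ⊗[R] (Fin n → R))
    (hδ : ∀ i, δ (Pi.basisFun R (Fin n) i) =
      ∑ j, a i j ⊗ₜ[R] (Pi.basisFun R (Fin n) j : Fin n → R))
    (δbar : ({j : Fin n // 2 ≤ (j : ℕ)} → R) →ₗ[R]
        A ⊗[R] ({j : Fin n // 2 ≤ (j : ℕ)} → R))
    (hδbar : ∀ i : {j : Fin n // 2 ≤ (j : ℕ)},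
      δbar (Pi.basisFun R {j : Fin n // 2 ≤ (j : ℕ)} i) =
        ∑ j : {j : Fin n // 2 ≤ (j : ℕ)},
          abar i.1 j.1 ⊗ₜ[R]
            (Pi.basisFun R {j : Fin n // 2 ≤ (j : ℕ)} j
              : {j : Fin n // 2 ≤ (j : ℕ)} → R))
    (εbar : ({j : Fin n // 2 ≤ (j : ℕ)} → R) →ₗ[R]
        ({j : Fin n // 2 ≤ (j : ℕ)} → R))
    (hεbar : ∀ i : {j : Fin n // 2 ≤ (j : ℕ)},
      εbar (Pi.basisFun R {j : Fin n // 2 ≤ (j : ℕ)} i) =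
        zsign (m i.1) • (Pi.basisFun R {j : Fin n // 2 ≤ (j : ℕ)} i
          : {j : Fin n // 2 ≤ (j : ℕ)} → R))
    (π : (Fin n → R) →ₗ[R] A ⊗[R] ({j : Fin n // 2 ≤ (j : ℕ)} → R))
    (hπ1 : π (Pi.basisFun R (Fin n) ⟨0, by omega⟩) = 0)
    (hπ2 : π (Pi.basisFun R (Fin n) ⟨1, by omega⟩) =
      - ∑ j : {j : Fin n // 2 ≤ (j : ℕ)},
          a ⟨0, by omega⟩ j.1 ⊗ₜ[R]
            (Pi.basisFun R {j : Fin n // 2 ≤ (j : ℕ)} j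
              : {j : Fin n // 2 ≤ (j : ℕ)} → R))
    (hπ3 : ∀ (i : Fin n) (hi : 2 ≤ (i : ℕ)),
      π (Pi.basisFun R (Fin n) i) =
        (1 : A) ⊗ₜ[R] (Pi.basisFun R {j : Fin n // 2 ≤ (j : ℕ)} ⟨i, hi⟩
          : {j : Fin n // 2 ≤ (j : ℕ)} → R)) :
    dstar δbar π - dstar π δ + (TensorProduct.map d εbar) ∘ₗ π = 0 := by
  set i₀ : Fin n := ⟨0, by omega⟩
  set i₁ : Fin n := ⟨1, by omega⟩
  obtain ⟨p, hp⟩ : ∃ p : Fin n → {j : Fin n // 2 ≤ (j : ℕ)} → A, p = fun i k =>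
      if i = i₀ then 0 else if i = i₁ then -a i₀ k.1 else if i = k.1 then 1 else 0 := ⟨_, rfl⟩
  have h10 : i₁ ≠ i₀ := by simp [i₀, i₁]
  have hs0 : ∀ j : {j : Fin n // 2 ≤ (j : ℕ)}, j.1 ≠ i₀ := by
    rintro ⟨j, hj⟩ rfl
    simp [i₀] at hj
  have hs1 : ∀ j : {j : Fin n // 2 ≤ (j : ℕ)}, j.1 ≠ i₁ := by
    rintro ⟨j, hj⟩ rfl
    simp [i₁] at hj
  have hp0 : ∀ k, p i₀ k = 0 := by simp [hp]
  have hp1 : ∀ k, p i₁ k = -a i₀ k.1 := by simp [hp, h10]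
  have hp2 : ∀ j k : {j : Fin n // 2 ≤ (j : ℕ)}, p j.1 k = if j = k then 1 else 0 := by
    intro j k
    simp [hp, hs0, hs1, Subtype.ext_iff]
  have hcases : ∀ i : Fin n, i = i₀ ∨ i = i₁ ∨ 2 ≤ (i : ℕ) := by
    intro i
    simp only [i₀, i₁, Fin.ext_iff]
    omega
  have hπ : ∀ i, π (Pi.basisFun R (Fin n) i) =
      ∑ k, p i k ⊗ₜ[R] (Pi.basisFun R {j : Fin n // 2 ≤ (j : ℕ)} k) := by
    intro i
    rcases hcases i with rfl | rfl | hi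
    · simp only [hπ1, hp0, TensorProduct.zero_tmul, Finset.sum_const_zero]
    · simp only [hp1, TensorProduct.neg_tmul, Finset.sum_neg_distrib]
      exact hπ2
    · rw [hπ3 i hi]
      simp only [hp2 ⟨i, hi⟩, TensorProduct.ite_tmul, Finset.sum_ite_eq,
        Finset.mem_univ, if_true]
  have hsum : ∑ j : {j : Fin n // 2 ≤ (j : ℕ)}, a i₀ j.1 * a j.1 i₁ = 0 := by
    have h := hstruct i₀ i₁
    rw [sum_fin_eq_add_add_sum_two_le (i₀ := i₀) (i₁ := i₁) rfl rfl] at h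
    simpa [ha12, hd1, haii] using h
  have hcoeff : ∀ i k, ∑ j, p i j * abar j.1 k.1 - ∑ j, a i j * p j k
      + zsign (m k.1) • d (p i k) = 0 := by
    intro i k
    have hcomp : ∑ j, a i j * p j k = abar i k.1 := by
      rw [sum_fin_eq_add_add_sum_two_le (i₀ := i₀) (i₁ := i₁) rfl rfl]
      simp only [hp0, hp1, hp2, habar, mul_ite, mul_one, mul_zero,
        Finset.sum_ite_eq', Finset.mem_univ, if_true]
      noncomm_ring
    rw [hcomp]
    rcases hcases i with rfl | rfl | hi
    · simp [hp0, habar, ha12]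
    · have h := hstruct i₀ k.1
      rw [sum_fin_eq_add_add_sum_two_le (i₀ := i₀) (i₁ := i₁) rfl rfl] at h
      simp only [haii, ha12, zero_mul, one_mul, zero_add] at h
      simp only [hp1, habar, haii, zero_mul, sub_zero, neg_mul, mul_sub, ← mul_assoc,
        Finset.sum_neg_distrib, Finset.sum_sub_distrib, ← Finset.sum_mul, hsum, map_neg, smul_neg]
      rw [← neg_eq_zero]
      refine Eq.trans ?_ h
      abel
    · have hi' : ∀ j, p i j = if (⟨i, hi⟩ : {j : Fin n // 2 ≤ (j : ℕ)}) = j then 1 else 0 :=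
        hp2 ⟨i, hi⟩
      simp only [hi', ite_mul, one_mul, zero_mul, Finset.sum_ite_eq, Finset.mem_univ, if_true]
      split_ifs <;> simp [hd1]
  refine (Pi.basisFun R (Fin n)).ext fun i => ?_
  rw [LinearMap.add_apply, LinearMap.sub_apply, LinearMap.comp_apply,
    dstar_apply_of_coeff δbar π (hπ i) hδbar, dstar_apply_of_coeff π δ (hδ i) hπ, hπ i]
  simp only [map_sum, TensorProduct.map_tmul, hεbar]
  rw [← Finset.sum_sub_distrib, ← Finset.sum_add_distrib]
  refine Finset.sum_eq_zero fun k _ => ?_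
  rw [TensorProduct.tmul_smul, TensorProduct.smul_tmul', ← TensorProduct.sub_tmul,
    ← TensorProduct.add_tmul, hcoeff, TensorProduct.zero_tmul]

end
end

section
/- Right compatibility of homotopy with composition: let N₀, N, N' be free R-modules with finite bases and integer degree functions m⁰, m, m', and let δ⁰ : N₀ → A ⊗[R] N₀, δ : N → A ⊗[R] N, δ' : N' → A ⊗[R] N' be R-linear maps. Suppose ν : N₀ → A ⊗[R] N is a D-structure morphism from (N₀, δ⁰) to (N, δ) whose coefficients g i p lie in 𝒜 (m⁰ i − m p) for all i, p, and ψ, ψ' : N → A ⊗[R] N' are homotopic via H as maps from (N, δ) to (N', δ'), where the coefficients h p r of H lie in 𝒜 (m p − m' r − 1) for all p, r. Then ψ ∗ ν and ψ' ∗ ν are homotopic via H ∗ ν as maps from (N₀, δ⁰) to (N', δ'). -/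
open TensorProduct

noncomputable section

theorem zsign_add (a b : ℤ) : zsign (a + b) = zsign a * zsign b := by
  simp [zsign, zpow_add]

theorem zsign_mul_sub_sub_one (a b : ℤ) : zsign b * zsign (a - b - 1) = -zsign a := by
  have hsub : b + (a - b - 1) = a + -1 := by ring
  rw [← zsign_add, hsub, zsign_add]
  simp [zsign]

section Collapse

variable {R A : Type*} [CommRing R] [Ring A] [Algebra R A]
  {M₁ M₂ M₃ M₄ : Type*} [AddCommGroup M₁] [Module R M₁] [AddCommGroup M₂] [Module R M₂]
  [AddCommGroup M₃] [Module R M₃] [AddCommGroup M₄] [Module R M₄]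

@[simp]
theorem mu2_tmul_tmul_s11 (a b : A) (x : M₁) :
    mu2 R A M₁ (a ⊗ₜ[R] (b ⊗ₜ[R] x)) = (a * b) ⊗ₜ[R] x := by
  simp [mu2]

theorem dstar_apply (f : M₂ →ₗ[R] A ⊗[R] M₃) (g : M₁ →ₗ[R] A ⊗[R] M₂) (x : M₁) :
    dstar f g x = mu2 R A M₃ (LinearMap.lTensor A f (g x)) := rfl

theorem dstar_add_left (f f' : M₂ →ₗ[R] A ⊗[R] M₃) (g : M₁ →ₗ[R] A ⊗[R] M₂) :
    dstar (f + f') g = dstar f g + dstar f' g := by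
  ext x
  simp [dstar_apply, LinearMap.lTensor_add]

theorem dstar_sub_left (f f' : M₂ →ₗ[R] A ⊗[R] M₃) (g : M₁ →ₗ[R] A ⊗[R] M₂) :
    dstar (f - f') g = dstar f g - dstar f' g := by
  ext x
  simp [dstar_apply, LinearMap.lTensor_sub]

theorem dstar_sub_right (f : M₂ →ₗ[R] A ⊗[R] M₃) (g g' : M₁ →ₗ[R] A ⊗[R] M₂) :
    dstar f (g - g') = dstar f g - dstar f g' := by
  ext x
  simp [dstar_apply]

theorem mu2_lTensor_mu2 (f : M₁ →ₗ[R] A ⊗[R] M₂) (a : A) (z : A ⊗[R] M₁) :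
    mu2 R A M₂ (LinearMap.lTensor A f (mu2 R A M₁ (a ⊗ₜ[R] z))) =
      mu2 R A M₂ (a ⊗ₜ[R] mu2 R A M₂ (LinearMap.lTensor A f z)) := by
  induction z with
  | zero => simp
  | add y z hy hz => simp only [tmul_add, map_add, hy, hz]
  | tmul b x =>
    simp only [mu2_tmul_tmul_s11, LinearMap.lTensor_tmul]
    induction f x with
    | zero => simp
    | add y z hy hz => simp only [tmul_add, map_add, hy, hz]
    | tmul c y => simp [mul_assoc]

theorem dstar_assoc (f : M₃ →ₗ[R] A ⊗[R] M₄) (g : M₂ →ₗ[R] A ⊗[R] M₃)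
    (h : M₁ →ₗ[R] A ⊗[R] M₂) : dstar (dstar f g) h = dstar f (dstar g h) := by
  ext x
  simp only [dstar_apply]
  induction h x with
  | zero => simp
  | add y z hy hz => simp only [map_add, hy, hz]
  | tmul a y => simp only [LinearMap.lTensor_tmul, mu2_lTensor_mu2, dstar_apply]

end Collapse

/-- The signed Leibniz rule for `d ⊗ ε` with respect to the composition `∗`, for a left factor `H`
of degree `-1`. -/
theorem map_comp_dstar
    {R A : Type*} [CommRing R] [Ring A] [Algebra R A] (𝒜 : ℤ → Submodule R A) (d : A →ₗ[R] A)
    (hLeib : ∀ (j : ℤ) (α β : A), β ∈ 𝒜 j →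
      d (α * β) = zsign j • (d α * β) + α * d β)
    {ι₀ ι ι' M₀ M M' : Type*} [Fintype ι] [Fintype ι']
    [AddCommGroup M₀] [Module R M₀] [AddCommGroup M] [Module R M] [AddCommGroup M'] [Module R M']
    (u : Module.Basis ι₀ R M₀) (v : ι → M) (w : ι' → M') (m : ι → ℤ) (m' : ι' → ℤ)
    (ε : M →ₗ[R] M) (hε : ∀ p, ε (v p) = zsign (m p) • v p)
    (ε' : M' →ₗ[R] M') (hε' : ∀ r, ε' (w r) = zsign (m' r) • w r)
    (ν : M₀ →ₗ[R] A ⊗[R] M) (g : ι₀ → ι → A) (hg : ∀ i, ν (u i) = ∑ p, g i p ⊗ₜ[R] v p)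
    (H : M →ₗ[R] A ⊗[R] M') (h : ι → ι' → A) (hh : ∀ p, H (v p) = ∑ r, h p r ⊗ₜ[R] w r)
    (hhdeg : ∀ p r, h p r ∈ 𝒜 (m p - m' r - 1)) :
    TensorProduct.map d ε' ∘ₗ dstar H ν =
      dstar (TensorProduct.map d ε' ∘ₗ H) ν - dstar H (TensorProduct.map d ε ∘ₗ ν) := by
  refine u.ext fun i => ?_
  simp only [LinearMap.sub_apply, LinearMap.comp_apply, dstar_apply, hg, map_sum,
    LinearMap.lTensor_tmul, hh, tmul_sum, mu2_tmul_tmul_s11, TensorProduct.map_tmul, hε, hε',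
    ← Finset.sum_sub_distrib]
  refine Finset.sum_congr rfl fun p _ => ?_
  simp only [map_zsmul, hh, Finset.smul_sum, tmul_sum, map_sum, ← Finset.sum_sub_distrib]
  refine Finset.sum_congr rfl fun r _ => ?_
  simp only [hLeib _ _ _ (hhdeg p r), tmul_smul, map_zsmul, add_tmul, smul_add, ← smul_tmul',
    smul_smul, zsign_mul_sub_sub_one, mu2_tmul_tmul_s11]
  module

/-- right compatibility of homotopy with composition: if `ν` is a
`D`-structure morphism from `(N₀, δ⁰)` to `(N, δ)` with coefficients
`g i p ∈ 𝒜 (m⁰ i − m p)`, and `ψ ≃_H ψ'` as maps from `(N, δ)` to `(N', δ')`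
where the coefficients `h p r` of `H` lie in `𝒜 (m p − m' r − 1)`, then
`ψ ∗ ν ≃_{H ∗ ν} ψ' ∗ ν` as maps from `(N₀, δ⁰)` to `(N', δ')`. -/
theorem homotopy_comp_right
    {R A : Type*} [CommRing R] [Ring A] [Algebra R A]
    (𝒜 : ℤ → Submodule R A) [GradedAlgebra 𝒜]
    (d : A →ₗ[R] A) (hd1 : d 1 = 0)
    (hLeib : ∀ (j : ℤ) (α β : A), β ∈ 𝒜 j →
      d (α * β) = zsign j • (d α * β) + α * d β)
    {ι₀ ι ι' : Type*} [Fintype ι₀] [DecidableEq ι₀] [Fintype ι] [DecidableEq ι]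
    [Fintype ι'] [DecidableEq ι']
    (m₀ : ι₀ → ℤ) (m : ι → ℤ) (m' : ι' → ℤ)
    (δ₀ : (ι₀ → R) →ₗ[R] A ⊗[R] (ι₀ → R))
    (δ : (ι → R) →ₗ[R] A ⊗[R] (ι → R))
    (δ' : (ι' → R) →ₗ[R] A ⊗[R] (ι' → R))
    (ε : (ι → R) →ₗ[R] (ι → R))
    (hε : ∀ p, ε (Pi.basisFun R ι p) =
      zsign (m p) • (Pi.basisFun R ι p : ι → R))
    (ε' : (ι' → R) →ₗ[R] (ι' → R))
    (hε' : ∀ r, ε' (Pi.basisFun R ι' r) =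
      zsign (m' r) • (Pi.basisFun R ι' r : ι' → R))
    (ν : (ι₀ → R) →ₗ[R] A ⊗[R] (ι → R))
    (hν : dstar δ ν - dstar ν δ₀ + (TensorProduct.map d ε) ∘ₗ ν = 0)
    (g : ι₀ → ι → A)
    (hg : ∀ i, ν (Pi.basisFun R ι₀ i) =
      ∑ p, g i p ⊗ₜ[R] (Pi.basisFun R ι p : ι → R))
    (hgdeg : ∀ i p, g i p ∈ 𝒜 (m₀ i - m p))
    (ψ ψ' H : (ι → R) →ₗ[R] A ⊗[R] (ι' → R))
    (hHom : ψ - ψ' =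
      dstar H δ + dstar δ' H + (TensorProduct.map d ε') ∘ₗ H)
    (h : ι → ι' → A)
    (hh : ∀ p, H (Pi.basisFun R ι p) =
      ∑ r, h p r ⊗ₜ[R] (Pi.basisFun R ι' r : ι' → R))
    (hhdeg : ∀ p r, h p r ∈ 𝒜 (m p - m' r - 1)) :
    dstar ψ ν - dstar ψ' ν =
      dstar (dstar H ν) δ₀ + dstar δ' (dstar H ν)
        + (TensorProduct.map d ε') ∘ₗ dstar H ν := by
  rw [← dstar_sub_left, hHom, dstar_add_left, dstar_add_left, dstar_assoc, dstar_assoc, dstar_assoc,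
    map_comp_dstar 𝒜 d hLeib (Pi.basisFun R ι₀) (Pi.basisFun R ι) (Pi.basisFun R ι') m m'
      ε hε ε' hε' ν g hg H h hh hhdeg]
  have hδν : dstar δ ν = dstar ν δ₀ - TensorProduct.map d ε ∘ₗ ν := by
    rw [← sub_eq_zero, ← hν]
    abel
  rw [hδν, dstar_sub_right]
  abel

end
end
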